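/- Ramanujan's identity: Li₂(−1/8) + Li₂(1/9) = −(1/2)·(ln(9/8))². -/

import Mathlib

open Real

/-- The dilogarithm, `Li₂(z) = ∑_{k=1}^∞ z^k / k²`. -/
noncomputable def Li2 (z : ℝ) : ℝ := ∑' k : ℕ, z ^ (k + 1) / ((k : ℝ) + 1) ^ 2

theorem Li2_zero : Li2 0 = 0 := by
  simp [Li2]

theorem hasDerivAt_Li2_tsum {z : ℝ} (hz : |z| < 1) :
    HasDerivAt Li2 (∑' k : ℕ, z ^ k / ((k : ℝ) + 1)) z := by
  obtain ⟨r, hzr, hr⟩ := exists_between hz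
  have hr0 : 0 ≤ r := (abs_nonneg z).trans hzr.le
  refine hasDerivAt_tsum_of_isPreconnected (𝕜 := ℝ)
    (g := fun (k : ℕ) (y : ℝ) => y ^ (k + 1) / ((k : ℝ) + 1) ^ 2)
    (g' := fun (k : ℕ) (y : ℝ) => y ^ k / ((k : ℝ) + 1)) (t := Metric.ball (0 : ℝ) r) (u := fun k : ℕ => r ^ k)
    (y₀ := 0) (summable_geometric_of_lt_one hr0 hr) Metric.isOpen_ball
    (convex_ball _ _).isPreconnected (fun k y _ => ?_) (fun k y hy => ?_) ?_ ?_ ?_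
  · have hk : (k : ℝ) + 1 ≠ 0 := by positivity
    convert! (hasDerivAt_pow (k + 1) y).div_const (((k : ℝ) + 1) ^ 2) using 1
    push_cast
    field_simp
  · rw [mem_ball_zero_iff, Real.norm_eq_abs] at hy
    rw [norm_div, norm_pow, Real.norm_eq_abs, Real.norm_of_nonneg (by positivity)]
    refine (div_le_self (by positivity) (by simp)).trans ?_
    gcongr
  · simpa using (abs_nonneg z).trans_lt hzr
  · simp
  · simpa using hzr

theorem hasDerivAt_Li2 {z : ℝ} (hz : |z| < 1) (hz0 : z ≠ 0) :
    HasDerivAt Li2 (-log (1 - z) / z) z := by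
  convert hasDerivAt_Li2_tsum hz using 1
  rw [← (hasSum_pow_div_log_of_abs_lt_one hz).tsum_eq, ← tsum_div_const]
  refine tsum_congr fun k => ?_
  field_simp
  ring

theorem Li2_neg_add_Li2_div_one_add {x : ℝ} (hx0 : 0 < x) (hx1 : x < 1) :
    Li2 (-x) + Li2 (x / (1 + x)) = -(1 / 2) * log (1 + x) ^ 2 := by
  have hw : ∀ y : ℝ, 0 ≤ y → |y / (1 + y)| < 1 := fun y hy => by
    rw [abs_of_nonneg (by positivity), div_lt_one (by positivity)]
    linarith
  have hn : ∀ y : ℝ, 0 ≤ y → y < 1 → |-y| < 1 := fun y hy hy1 => by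
    rwa [abs_neg, abs_of_nonneg hy]
  have hdiv : ∀ y : ℝ, 0 ≤ y →
      HasDerivAt (fun t : ℝ => t / (1 + t)) (1 / (1 + y) ^ 2) y := fun y hy => by
    convert! (hasDerivAt_id y).div ((hasDerivAt_id y).const_add 1)
      (by simp only [id]; positivity) using 1
    simp
  have hlog : ∀ y : ℝ, 0 ≤ y →
      HasDerivAt (fun t : ℝ => 1 / 2 * log (1 + t) ^ 2) (log (1 + y) / (1 + y)) y :=
    fun y hy => by
      convert! ((((hasDerivAt_id y).const_add 1).log
        (by simp only [id]; positivity)).pow 2).const_mul (1 / 2) using 1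
      simp
      ring
  obtain ⟨c, -, hc⟩ := exists_hasDerivAt_eq_slope
    (fun t : ℝ => Li2 (-t) + Li2 (t / (1 + t)) + 1 / 2 * log (1 + t) ^ 2) (fun _ => 0) hx0
    (fun y hy => by
      have h1 := (hasDerivAt_Li2_tsum (hn y hy.1 (hy.2.trans_lt hx1))).comp y (hasDerivAt_neg y)
      have h2 := (hasDerivAt_Li2_tsum (hw y hy.1)).comp y (hdiv y hy.1)
      exact ((h1.add h2).add (hlog y hy.1)).continuousAt.continuousWithinAt)
    (fun y hy => by
      have hy0 : y ≠ 0 := hy.1.ne'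
      have hy1 : 1 + y ≠ 0 := by linarith [hy.1]
      have h1 := (hasDerivAt_Li2 (hn y hy.1.le (hy.2.trans hx1)) (neg_ne_zero.2 hy0)).comp y
        (hasDerivAt_neg y)
      have h2 := (hasDerivAt_Li2 (hw y hy.1.le) (div_ne_zero hy0 hy1)).comp y (hdiv y hy.1.le)
      convert! (h1.add h2).add (hlog y hy.1.le) using 1
      have he : 1 - y / (1 + y) = (1 + y)⁻¹ := by
        field_simp
        ring
      rw [he, log_inv, sub_neg_eq_add]
      field_simp
      ring)
  have hF := (div_eq_zero_iff.1 hc.symm).resolve_right (by linarith)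
  simp [Li2_zero] at hF
  linarith

theorem stmt_17 :
    Li2 (-(1 / 8)) + Li2 (1 / 9) = -(1 / 2) * (Real.log (9 / 8)) ^ 2 := by
  have h := Li2_neg_add_Li2_div_one_add (x := 1 / 8) (by norm_num) (by norm_num)
  norm_num at h ⊢
  exact h
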